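/- arXiv:2504.12201 — 6 statements merged into one kernel-verified Lean document; each statement's English description precedes it below -/
import Mathlib

section
/- Let Γ be a simple graph with vertex set V of cardinality m, let 1 ≤ r ≤ m−1 and let d ≥ 0. The map sending a pair (E,U) — where E is a set of d pairwise vertex-disjoint edges of Γ and U is a set of r−d vertices of Γ none of which is an endpoint of an edge of E — to the pair (E, V ∖ (endpoints(E) ∪ U)) is a bijection from the set of all such pairs onto the set of pairs (E′,U′) where E′ is a set of d pairwise vertex-disjoint edges of Γ and U′ is a set of (m−r)−d vertices none of which is an endpoint of an edge of E′. Moreover this bijection is compatible with the face structure: if a pair is modified by removing an edge e = {u,w} from E and adjoining its endpoint u to the vertex set, then its image under the bijection is modified by removing e and adjoining the other endpoint w to the complementary vertex set. -/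
open Finset

/-- The set of endpoints of a finite set of edges (unordered pairs) of vertices. -/
noncomputable def endpointSet {V : Type*} [Fintype V] [DecidableEq V]
    (E : Finset (Sym2 V)) : Finset V :=
  haveI := Classical.dec
  Finset.univ.filter (fun v => ∃ e ∈ E, v ∈ e)

/-- `IsCell Γ k d (E, U)` says that `E` is a set of `d` pairwise vertex-disjoint edges
of the simple graph `Γ` and that `U` is a set of `k - d` vertices of `Γ` none of
which is an endpoint of an edge of `E` (the cardinality condition is stated as
`|U| + d = k`). -/
def IsCell {V : Type*} (Γ : SimpleGraph V) (k d : ℕ)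
    (c : Finset (Sym2 V) × Finset V) : Prop :=
  c.1.card = d ∧ c.2.card + d = k ∧
    (∀ e ∈ c.1, e ∈ Γ.edgeSet) ∧
    (∀ e ∈ c.1, ∀ e' ∈ c.1, e ≠ e' → ∀ v : V, v ∈ e → v ∉ e') ∧
    (∀ u ∈ c.2, ∀ e ∈ c.1, u ∉ e)

/-- The duality map `(E, U) ↦ (E, V \ (endpoints(E) ∪ U))`. -/
noncomputable def dualMap {V : Type*} [Fintype V] [DecidableEq V]
    (c : Finset (Sym2 V) × Finset V) : Finset (Sym2 V) × Finset V :=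
  (c.1, (endpointSet c.1 ∪ c.2)ᶜ)

theorem mem_endpointSet_iff {V : Type*} [Fintype V] [DecidableEq V]
    (E : Finset (Sym2 V)) (v : V) : v ∈ endpointSet E ↔ ∃ e ∈ E, v ∈ e := by
  simp [endpointSet]

theorem card_endpointSet {V : Type*} [Fintype V] [DecidableEq V] (Γ : SimpleGraph V)
    (E : Finset (Sym2 V)) (h1 : ∀ e ∈ E, e ∈ Γ.edgeSet)
    (h2 : ∀ e ∈ E, ∀ e' ∈ E, e ≠ e' → ∀ v : V, v ∈ e → v ∉ e') :
    (endpointSet E).card = 2 * E.card := by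
  have h : endpointSet E = E.biUnion (fun e => e.toFinset) := by
    ext v
    simp [mem_endpointSet_iff]
  rw [h, Finset.card_biUnion, Finset.sum_congr rfl (g := fun _ => 2)]
  · simp [mul_comm]
  · intro e he
    exact Sym2.card_toFinset_of_not_isDiag e (Γ.not_isDiag_of_mem_edgeSet (h1 e he))
  · intro e he e' he' hne
    rw [Function.onFun, Finset.disjoint_left]
    intro v hv hv'
    exact h2 e he e' he' hne v (by simpa using hv) (by simpa using hv')

theorem dualMap_isCell {V : Type*} [Fintype V] [DecidableEq V] (Γ : SimpleGraph V)
    (r d : ℕ) (c : Finset (Sym2 V) × Finset V) (hc : IsCell Γ r d c) :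
    IsCell Γ (Fintype.card V - r) d (dualMap c) := by
  obtain ⟨h1, h2, h3, h4, h5⟩ := hc
  refine ⟨h1, ?_, h3, h4, ?_⟩
  · have hd : Disjoint (endpointSet c.1) c.2 := by
      rw [Finset.disjoint_left]
      intro v hv hv'
      obtain ⟨e, he, hve⟩ := (mem_endpointSet_iff _ _).1 hv
      exact h5 v hv' e he hve
    have hcard := Finset.card_union_of_disjoint hd
    rw [card_endpointSet Γ c.1 h3 h4] at hcard
    have hadd := Finset.card_add_card_compl (endpointSet c.1 ∪ c.2)
    simp only [dualMap]
    omega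
  · intro u hu e he hue
    simp only [dualMap, Finset.mem_compl, Finset.mem_union, not_or] at hu
    exact hu.1 ((mem_endpointSet_iff _ _).2 ⟨e, he, hue⟩)

theorem dualMap_dualMap {V : Type*} [Fintype V] [DecidableEq V] (Γ : SimpleGraph V)
    (r d : ℕ) (c : Finset (Sym2 V) × Finset V) (hc : IsCell Γ r d c) :
    dualMap (dualMap c) = c := by
  obtain ⟨h1, h2, h3, h4, h5⟩ := hc
  refine Prod.ext rfl ?_
  ext v
  have : v ∈ c.2 → v ∉ endpointSet c.1 := by
    intro hv hv'
    obtain ⟨e, he, hve⟩ := (mem_endpointSet_iff _ _).1 hv'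
    exact h5 v hv e he hve
  simp only [dualMap, Finset.mem_compl, Finset.mem_union]
  tauto

/-- Duality for discrete configuration spaces (Proposition 3.2): for a simple graph `Γ`
on `m` vertices and `1 ≤ r ≤ m - 1`, the map `(E, U) ↦ (E, V \ (endpoints(E) ∪ U))` is a
bijection from the `d`-dimensional cells of `UDConf(Γ, r)` onto the `d`-dimensional cells
of `UDConf(Γ, m - r)`; moreover it is compatible with the face structure: removing an edge
`e = s(u,w)` from `E` and adjoining `u` to the vertex part corresponds, on the image, to
removing `e` and adjoining the other endpoint `w` to the complementary vertex part. -/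
theorem stmt_0 {V : Type*} [Fintype V] [DecidableEq V] (Γ : SimpleGraph V)
    (m : ℕ) (hm : Fintype.card V = m) (r : ℕ) (hr1 : 1 ≤ r) (hr2 : r ≤ m - 1)
    (d : ℕ) :
    Set.BijOn dualMap {c | IsCell Γ r d c} {c | IsCell Γ (m - r) d c} ∧
      ∀ c : Finset (Sym2 V) × Finset V, IsCell Γ r d c → ∀ u w : V, s(u, w) ∈ c.1 →
        dualMap (c.1.erase s(u, w), insert u c.2) =
          ((dualMap c).1.erase s(u, w), insert w (dualMap c).2) := by
  subst hm
  refine ⟨⟨fun c hc => dualMap_isCell Γ r d c hc, ?_, ?_⟩, ?_⟩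
  · intro c hc c' hc' h
    rw [← dualMap_dualMap Γ r d c hc, h, dualMap_dualMap Γ r d c' hc']
  · intro c hc
    refine ⟨dualMap c, ?_, dualMap_dualMap Γ _ d c hc⟩
    have h := dualMap_isCell Γ _ d c hc
    have hr : Fintype.card V - (Fintype.card V - r) = r := by omega
    rw [hr] at h
    exact h
  · rintro c ⟨h1, h2, h3, h4, h5⟩ u w he
    refine Prod.ext rfl ?_
    have huw : u ≠ w := (show Γ.Adj u w from h3 _ he).ne
    ext v
    simp only [dualMap, Finset.mem_compl, Finset.mem_union, Finset.mem_insert,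
      mem_endpointSet_iff, Finset.mem_erase]
    constructor
    · intro h
      by_cases hv : v = w
      · exact Or.inl hv
      · right
        rintro (⟨e, hE, hve⟩ | hU)
        · by_cases hee : e = s(u, w)
          · subst hee
            rcases Sym2.mem_iff.1 hve with h' | h'
            · exact h (Or.inr (Or.inl h'))
            · exact hv h'
          · exact h (Or.inl ⟨e, ⟨hee, hE⟩, hve⟩)
        · exact h (Or.inr (Or.inr hU))
    · rintro (rfl | h)
      · rintro (⟨e, ⟨hne, hE⟩, hve⟩ | hU | hU)
        · exact h4 e hE _ he hne v hve (Sym2.mem_mk_right u v)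
        · exact huw hU.symm
        · exact h5 v hU _ he (Sym2.mem_mk_right u v)
      · rintro (⟨e, ⟨hne, hE⟩, hve⟩ | hU | hU)
        · exact h (Or.inl ⟨e, hE, hve⟩)
        · exact h (Or.inl ⟨_, he, hU ▸ Sym2.mem_mk_left u w⟩)
        · exact h (Or.inr hU)
end

section
/- Let p ≥ 3 be an integer. Let P be the group presented by generators b_1, a_2, …, a_{p−1}, b_2, …, b_{p−1} subject to the relations b_i a_j b_i⁻¹ b_1 a_j⁻¹ b_1⁻¹ = 1 for all 2 ≤ i < j ≤ p−1, and let R be the group presented by generators x_2, …, x_{p−1}, y_1, …, y_{p−1} subject to the relations y_i x_j = x_j y_i for all 2 ≤ i < j ≤ p−1. Then the assignment a_i ↦ x_i (2 ≤ i ≤ p−1), b_i ↦ y_1 y_i⁻¹ (2 ≤ i ≤ p−1), b_1 ↦ y_1 defines an isomorphism from P onto R. -/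
/-- Index type for the generators `a_2, …, a_{p-1}` (resp. `x_2, …, x_{p-1}`). -/
abbrev AIdx (p : ℕ) := {i : ℕ // 2 ≤ i ∧ i ≤ p - 1}

/-- Index type for the generators `b_1, …, b_{p-1}` (resp. `y_1, …, y_{p-1}`). -/
abbrev BIdx (p : ℕ) := {i : ℕ // 1 ≤ i ∧ i ≤ p - 1}

/-- Relations of the group `P`: `b_i a_j b_i⁻¹ b_1 a_j⁻¹ b_1⁻¹ = 1` for `2 ≤ i < j ≤ p-1`.
Here `a_j` is `Sum.inl ⟨j, _⟩` and `b_i` is `Sum.inr ⟨i, _⟩`. -/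
def Prels (p : ℕ) (hp : 3 ≤ p) : Set (FreeGroup (AIdx p ⊕ BIdx p)) :=
  {rel | ∃ i j : ℕ, ∃ _ : 2 ≤ i, ∃ _ : i < j, ∃ _ : j ≤ p - 1,
    rel = FreeGroup.of (.inr ⟨i, by omega⟩) * FreeGroup.of (.inl ⟨j, by omega⟩) *
        (FreeGroup.of (.inr ⟨i, by omega⟩))⁻¹ * FreeGroup.of (.inr ⟨1, by omega⟩) *
        (FreeGroup.of (.inl ⟨j, by omega⟩))⁻¹ * (FreeGroup.of (.inr ⟨1, by omega⟩))⁻¹}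

/-- Relations of the group `R`: `y_i x_j y_i⁻¹ x_j⁻¹ = 1` (i.e. `y_i x_j = x_j y_i`)
for `2 ≤ i < j ≤ p-1`.  Here `x_j` is `Sum.inl ⟨j, _⟩` and `y_i` is `Sum.inr ⟨i, _⟩`. -/
def Rrels (p : ℕ) (hp : 3 ≤ p) : Set (FreeGroup (AIdx p ⊕ BIdx p)) :=
  {rel | ∃ i j : ℕ, ∃ _ : 2 ≤ i, ∃ _ : i < j, ∃ _ : j ≤ p - 1,
    rel = FreeGroup.of (.inr ⟨i, by omega⟩) * FreeGroup.of (.inl ⟨j, by omega⟩) *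
        (FreeGroup.of (.inr ⟨i, by omega⟩))⁻¹ * (FreeGroup.of (.inl ⟨j, by omega⟩))⁻¹}

/-- Images of the generators of `P` in `R`. -/
def fwdGen (p : ℕ) (hp : 3 ≤ p) : AIdx p ⊕ BIdx p → PresentedGroup (Rrels p hp)
  | .inl a => PresentedGroup.of (.inl a)
  | .inr b => if b.1 = 1 then PresentedGroup.of (.inr b) else
      PresentedGroup.of (.inr ⟨1, by omega⟩) * (PresentedGroup.of (.inr b))⁻¹

/-- Images of the generators of `R` in `P`. -/
def bwdGen (p : ℕ) (hp : 3 ≤ p) : AIdx p ⊕ BIdx p → PresentedGroup (Prels p hp)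
  | .inl a => PresentedGroup.of (.inl a)
  | .inr b => if b.1 = 1 then PresentedGroup.of (.inr b) else
      (PresentedGroup.of (.inr b))⁻¹ * PresentedGroup.of (.inr ⟨1, by omega⟩)

theorem fwd_rels (p : ℕ) (hp : 3 ≤ p) :
    ∀ r ∈ Prels p hp, FreeGroup.lift (fwdGen p hp) r = 1 := by
  rintro r ⟨i, j, h2, hij, hj, rfl⟩
  have hi : i ≠ 1 := by omega
  have key : (PresentedGroup.of (.inr ⟨i, by omega⟩) * PresentedGroup.of (.inl ⟨j, by omega⟩) *
      (PresentedGroup.of (.inr ⟨i, by omega⟩))⁻¹ * (PresentedGroup.of (.inl ⟨j, by omega⟩))⁻¹ :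
      PresentedGroup (Rrels p hp)) = 1 :=
    PresentedGroup.one_of_mem ⟨i, j, h2, hij, hj, rfl⟩
  simp only [map_mul, map_inv, FreeGroup.lift_apply_of, fwdGen, hi, if_true, if_false]
  generalize (PresentedGroup.of (.inr ⟨i, _⟩) : PresentedGroup (Rrels p hp)) = y at *
  generalize (PresentedGroup.of (.inl ⟨j, _⟩) : PresentedGroup (Rrels p hp)) = x at *
  have h : y * x = x * y := by
    rw [mul_inv_eq_one, mul_inv_eq_iff_eq_mul] at key; exact key
  have h' : y⁻¹ * x * y = x := by rw [mul_assoc, ← h]; group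
  generalize (PresentedGroup.of (.inr ⟨1, _⟩) : PresentedGroup (Rrels p hp)) = z at *
  calc _ = z * (y⁻¹ * x * y) * x⁻¹ * z⁻¹ := by group
    _ = 1 := by rw [h']; group

theorem bwd_rels (p : ℕ) (hp : 3 ≤ p) :
    ∀ r ∈ Rrels p hp, FreeGroup.lift (bwdGen p hp) r = 1 := by
  rintro r ⟨i, j, h2, hij, hj, rfl⟩
  have hi : i ≠ 1 := by omega
  have key : (PresentedGroup.of (.inr ⟨i, by omega⟩) * PresentedGroup.of (.inl ⟨j, by omega⟩) *
      (PresentedGroup.of (.inr ⟨i, by omega⟩))⁻¹ * PresentedGroup.of (.inr ⟨1, by omega⟩) *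
      (PresentedGroup.of (.inl ⟨j, by omega⟩))⁻¹ * (PresentedGroup.of (.inr ⟨1, by omega⟩))⁻¹ :
      PresentedGroup (Prels p hp)) = 1 :=
    PresentedGroup.one_of_mem ⟨i, j, h2, hij, hj, rfl⟩
  simp only [map_mul, map_inv, FreeGroup.lift_apply_of, bwdGen, hi, if_false]
  generalize (PresentedGroup.of (.inr ⟨i, _⟩) : PresentedGroup (Prels p hp)) = b at *
  generalize (PresentedGroup.of (.inl ⟨j, _⟩) : PresentedGroup (Prels p hp)) = a at *
  generalize (PresentedGroup.of (.inr ⟨1, _⟩) : PresentedGroup (Prels p hp)) = c at *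
  have h : b * a * b⁻¹ = c * a * c⁻¹ := by
    rw [← mul_inv_eq_one, ← key]; group
  calc _ = b⁻¹ * (c * a * c⁻¹) * b * a⁻¹ := by group
    _ = 1 := by rw [← h]; group

/-- Theorem 1.2 (group-theoretic core).  For `p ≥ 3`, the assignment
`a_i ↦ x_i`, `b_i ↦ y_1 y_i⁻¹` (for `2 ≤ i ≤ p-1`) and `b_1 ↦ y_1` defines an
isomorphism from the group `P` presented by generators `b_1, a_2, …, a_{p-1},
b_2, …, b_{p-1}` and relations `b_i a_j b_i⁻¹ b_1 a_j⁻¹ b_1⁻¹ = 1` (`2 ≤ i < j ≤ p-1`)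
onto the group `R` presented by generators `x_2, …, x_{p-1}, y_1, …, y_{p-1}` and
relations `y_i x_j = x_j y_i` (`2 ≤ i < j ≤ p-1`). -/
theorem stmt_1 (p : ℕ) (hp : 3 ≤ p) :
    ∃ e : PresentedGroup (Prels p hp) ≃* PresentedGroup (Rrels p hp),
      (∀ i : ℕ, ∀ h2 : 2 ≤ i, ∀ hi : i ≤ p - 1,
        e (PresentedGroup.of (.inl ⟨i, ⟨h2, hi⟩⟩)) =
          PresentedGroup.of (.inl ⟨i, ⟨h2, hi⟩⟩)) ∧
      (∀ i : ℕ, ∀ h2 : 2 ≤ i, ∀ hi : i ≤ p - 1,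
        e (PresentedGroup.of (.inr ⟨i, ⟨by omega, hi⟩⟩)) =
          PresentedGroup.of (.inr ⟨1, by omega⟩) *
            (PresentedGroup.of (.inr ⟨i, ⟨by omega, hi⟩⟩))⁻¹) ∧
      e (PresentedGroup.of (.inr ⟨1, by omega⟩)) =
        PresentedGroup.of (.inr ⟨1, by omega⟩) := by
  let f := PresentedGroup.toGroup (fwd_rels p hp)
  let g := PresentedGroup.toGroup (bwd_rels p hp)
  have hf : ∀ x, f (PresentedGroup.of x) = fwdGen p hp x :=
    fun x => PresentedGroup.toGroup.of (fwd_rels p hp)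
  have hg : ∀ x, g (PresentedGroup.of x) = bwdGen p hp x :=
    fun x => PresentedGroup.toGroup.of (bwd_rels p hp)
  have hgf : g.comp f = MonoidHom.id _ := by
    refine PresentedGroup.ext ?_
    rintro (a | ⟨b, hb⟩)
    · simp [hf, hg, fwdGen, bwdGen]
    · by_cases h : b = 1 <;> simp [hf, hg, fwdGen, bwdGen, h]
  have hfg : f.comp g = MonoidHom.id _ := by
    refine PresentedGroup.ext ?_
    rintro (a | ⟨b, hb⟩)
    · simp [hf, hg, fwdGen, bwdGen]
    · by_cases h : b = 1 <;> simp [hf, hg, fwdGen, bwdGen, h]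
  refine ⟨MonoidHom.toMulEquiv f g hgf hfg, ?_, ?_, ?_⟩
  · intro i h2 hi
    exact hf (.inl ⟨i, ⟨h2, hi⟩⟩)
  · intro i h2 hi
    refine (hf _).trans ?_
    have h : i ≠ 1 := by omega
    simp [fwdGen, h]
  · refine (hf (.inr ⟨1, by omega⟩)).trans ?_
    simp [fwdGen]
end

section
/- Let p and n be integers with p ≤ n ≤ 2p−5, set φ := n − p, m_j := max(0, φ − ⌊j/2⌋), ι(r,t) := max(r,t) + 1, and ℓ(i) := 2⌊(i+1)/2⌋. Let i and j be integers with 1 ≤ i < 2φ and ℓ(i) < j ≤ n−2, and suppose φ > ⌊(j + i − ℓ(i) − 1)/2⌋. Define r := φ + ℓ(i) − i − ⌊(j−1)/2⌋, s := ⌊(j+ℓ(i))/2⌋ − i, t := i, u := ⌊(j−ℓ(i)−1)/2⌋, and v := p + i − ℓ(i) − 2 − ⌊j/2⌋. Then s ≥ u ≥ 0, t ≥ 1, v ≥ r ≥ 1, r + s + t + u + v = n − 2, ι(r,v) + ι(s,u) ≤ p − 1, and t ≤ 2(p − ι(r,v) − ι(s,u)); moreover s + t + u + 1 = j and m_i −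 m_j − s = 0. -/
/-- Proposition 5.7, first case.  Let `p ≤ n ≤ 2p - 5`, `φ := n - p`,
`m_j := max 0 (φ - ⌊j/2⌋)`, `ι(r,t) := max r t + 1`, and `ℓ(i) := 2⌊(i+1)/2⌋`.
For integers `1 ≤ i < 2φ` and `ℓ(i) < j ≤ n - 2` with `φ > ⌊(j + i - ℓ(i) - 1)/2⌋`,
the displayed 5-tuple `(r,s,t,u,v)` satisfies the admissibility conditions of the
unified relations, together with `s + t + u + 1 = j` and `m_i - m_j - s = 0`. -/
theorem stmt_6 (p n i j : ℤ) (hpn : p ≤ n) (hn : n ≤ 2 * p - 5)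
    (hi1 : 1 ≤ i) (hi2 : i < 2 * (n - p))
    (hj1 : 2 * ((i + 1) / 2) < j) (hj2 : j ≤ n - 2)
    (hcase : (j + i - 2 * ((i + 1) / 2) - 1) / 2 < n - p) :
    let φ : ℤ := n - p
    let m : ℤ → ℤ := fun k => max 0 (φ - k / 2)
    let l : ℤ := 2 * ((i + 1) / 2)
    let r : ℤ := φ + l - i - (j - 1) / 2
    let s : ℤ := (j + l) / 2 - i
    let t : ℤ := i
    let u : ℤ := (j - l - 1) / 2
    let v : ℤ := p + i - l - 2 - j / 2
    0 ≤ u ∧ u ≤ s ∧ 1 ≤ t ∧ 1 ≤ r ∧ r ≤ v ∧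
      r + s + t + u + v = n - 2 ∧
      (max r v + 1) + (max s u + 1) ≤ p - 1 ∧
      t ≤ 2 * (p - (max r v + 1) - (max s u + 1)) ∧
      s + t + u + 1 = j ∧ m i - m j - s = 0 := by
  intro φ m l r s t u v
  simp only [φ, m, l, r, s, t, u, v]
  obtain ⟨a, ha | ha⟩ := Int.even_or_odd' i <;> obtain ⟨b, hb | hb⟩ := Int.even_or_odd' j <;>
    subst ha <;> subst hb <;> refine ⟨?_, ?_, ?_, ?_, ?_, ?_, ?_, ?_, ?_, ?_⟩ <;> omega
end

section
/- Let p and n be integers with p ≤ n ≤ 2p−5 and set φ := n − p. For every 1 ≤ x ≤ n−1 and every w ∈ L_x, the conjugate G_{n−1} · w · G_{n−1}⁻¹ lies in L_{x+1} if x > 2φ or x is even, and lies in L_{x+2} otherwise (i.e., when x is odd and x ≤ 2φ). -/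
/-- Right-angled Artin relations on `N` generators (indexed `0, …, N-1`, standing for
`h_1, …, h_N`): commutators of generators whose indices differ by more than one. -/
def RaagRels (N : ℕ) : Set (FreeGroup (Fin N)) :=
  {rel | ∃ i j : Fin N, (i : ℕ) + 1 < (j : ℕ) ∧
    rel = FreeGroup.of i * FreeGroup.of j * (FreeGroup.of i)⁻¹ * (FreeGroup.of j)⁻¹}

/-- The right-angled Artin group `H_n` on generators `h_1, …, h_{n-1}` subject to
`h_i h_j = h_j h_i` whenever `|i - j| > 1`. -/
abbrev Hgrp (n : ℕ) := PresentedGroup (RaagRels (n - 1))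

/-- The generator `h_i` of `H_n`, for `1 ≤ i ≤ n-1` (and `1` for out-of-range indices). -/
def hgen (n : ℕ) (i : ℕ) : Hgrp n :=
  if h : 1 ≤ i ∧ i ≤ n - 1 then PresentedGroup.of (⟨i - 1, by omega⟩ : Fin (n - 1)) else 1

/-- `A(a,b) := h_a h_{a+1} ⋯ h_b` (the identity when `a > b`). -/
def Aprod (n a b : ℕ) : Hgrp n := ((List.range' a (b + 1 - a) 1).map (hgen n)).prod

/-- `E(a,b) := h_a h_{a+2} ⋯ h_b` for even `a, b` (the identity when `a > b`). -/
def Eprod (n a b : ℕ) : Hgrp n := ((List.range' a ((b + 2 - a) / 2) 2).map (hgen n)).prod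

/-- `O(a,b) := h_a h_{a+2} ⋯ h_b` for odd `a, b` (the identity when `a > b`). -/
def Oprod (n a b : ℕ) : Hgrp n := ((List.range' a ((b + 2 - a) / 2) 2).map (hgen n)).prod

/-- The elements `G_i` of `H_n` (with `φ := n - p`): `G_1 := h_1`,
`G_{2k} := O(3,2k-1)·E(2,2k)` and `G_{2k+1} := O(3,2k+1)·E(2,2k)` for `1 ≤ k ≤ φ`, and
`G_i := O(3,2φ+1)·E(2,2φ)·A(2φ+2,i)` for `2φ+2 ≤ i ≤ n-1`. -/
def Ggen (n p i : ℕ) : Hgrp n :=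
  if i = 1 then hgen n 1
  else if i ≤ 2 * (n - p) + 1 then
    if i % 2 = 0 then Oprod n 3 (i - 1) * Eprod n 2 i
    else Oprod n 3 i * Eprod n 2 (i - 1)
  else Oprod n 3 (2 * (n - p) + 1) * Eprod n 2 (2 * (n - p)) * Aprod n (2 * (n - p) + 2) i

/-- `L_m`: the subgroup of `H_n` generated by the `h_i` with `1 ≤ i ≤ min m (n-1)`. -/
def Lsub (n m : ℕ) : Subgroup (Hgrp n) :=
  Subgroup.closure {x | ∃ i : ℕ, 1 ≤ i ∧ i ≤ min m (n - 1) ∧ x = hgen n i}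

/-- `U_m`: the subgroup of `H_n` generated by the `h_i` with `max m 1 ≤ i ≤ n-1`. -/
def Usub (n m : ℕ) : Subgroup (Hgrp n) :=
  Subgroup.closure {x | ∃ i : ℕ, max m 1 ≤ i ∧ i ≤ n - 1 ∧ x = hgen n i}

theorem hgen_mem (n m i : ℕ) (h : i ≤ m) : hgen n i ∈ Lsub n m := by
  by_cases hi : 1 ≤ i ∧ i ≤ n - 1
  · exact Subgroup.subset_closure ⟨i, hi.1, le_min h hi.2, rfl⟩
  · rw [hgen, dif_neg hi]
    exact one_mem _

theorem Lsub_mono (n : ℕ) {a b : ℕ} (h : a ≤ b) : Lsub n a ≤ Lsub n b := by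
  refine Subgroup.closure_mono ?_
  rintro y ⟨i, h1, h2, rfl⟩
  exact ⟨i, h1, by omega, rfl⟩

theorem hgen_comm (n i j : ℕ) (h : i + 1 < j) : hgen n i * hgen n j = hgen n j * hgen n i := by
  by_cases hi : 1 ≤ i ∧ i ≤ n - 1
  · by_cases hj : 1 ≤ j ∧ j ≤ n - 1
    · rw [hgen, hgen, dif_pos hi, dif_pos hj]
      have key : PresentedGroup.mk (RaagRels (n - 1))
          (FreeGroup.of (⟨i - 1, by omega⟩ : Fin (n - 1)) *
            FreeGroup.of (⟨j - 1, by omega⟩ : Fin (n - 1)) *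
            (FreeGroup.of (⟨i - 1, by omega⟩ : Fin (n - 1)))⁻¹ *
            (FreeGroup.of (⟨j - 1, by omega⟩ : Fin (n - 1)))⁻¹) = 1 := by
        apply PresentedGroup.one_of_mem
        exact ⟨⟨i - 1, by omega⟩, ⟨j - 1, by omega⟩, by simp only; omega, rfl⟩
      simp only [map_mul, map_inv] at key
      exact mul_inv_eq_iff_eq_mul.mp (mul_inv_eq_one.mp key)
    · rw [hgen, hgen, dif_neg hj]; simp
  · rw [hgen, dif_neg hi]; simp

theorem conj_gen (n m i : ℕ) (h : i ≠ m + 1) (w : Hgrp n) (hw : w ∈ Lsub n m) :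
    hgen n i * w * (hgen n i)⁻¹ ∈ Lsub n m := by
  rcases Nat.lt_or_gt_of_ne h with h | h
  · have := hgen_mem n m i (by omega)
    exact mul_mem (mul_mem this hw) (inv_mem this)
  · have hc : hgen n i * w = w * hgen n i := by
      have hle : Lsub n m ≤ Subgroup.centralizer {hgen n i} := by
        refine (Subgroup.closure_le _).2 ?_
        rintro y ⟨j, h1, h2, rfl⟩
        refine Subgroup.mem_centralizer_singleton_iff.2 ?_
        exact hgen_comm n j i (by omega)
      exact (Subgroup.mem_centralizer_singleton_iff.1 (hle hw)).symm
    rw [hc, mul_inv_cancel_right]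
    exact hw

theorem conj_list (n m : ℕ) (l : List ℕ) (h : ∀ i ∈ l, i ≠ m + 1) (w : Hgrp n)
    (hw : w ∈ Lsub n m) : (l.map (hgen n)).prod * w * ((l.map (hgen n)).prod)⁻¹ ∈ Lsub n m := by
  induction l with
  | nil => simpa using hw
  | cons a l ih =>
    have h1 := ih (fun i hi => h i (List.mem_cons_of_mem _ hi))
    have h2 := conj_gen n m a (h a List.mem_cons_self) _ h1
    simpa [mul_assoc] using h2

theorem conj_A (n x k a : ℕ) (w : Hgrp n) (hw : w ∈ Lsub n x) :
    ((List.range' a k 1).map (hgen n)).prod * w * (((List.range' a k 1).map (hgen n)).prod)⁻¹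
      ∈ Lsub n (x + 1) := by
  induction k generalizing a with
  | zero => simpa using Lsub_mono n (Nat.le_succ x) hw
  | succ k ih =>
    by_cases ha : a ≤ x + 1
    · have h2 := conj_gen n (x + 1) a (by omega) _ (ih (a + 1))
      simpa [List.range'_succ, mul_assoc] using h2
    · refine Lsub_mono n (Nat.le_succ x) (conj_list n x _ ?_ w hw)
      intro i hi
      rw [List.mem_range'] at hi
      obtain ⟨t, _, rfl⟩ := hi
      omega

/-- Lemma 6.6, item 2 (generic form):  for `p ≤ n ≤ 2p - 5`, `1 ≤ x ≤ n-1` and any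
`w` in the subgroup `L_x` of `H_n`, the conjugate `G_{n-1} w G_{n-1}⁻¹` lies in
`L_{x+1}` if `x > 2φ` or `x` is even, and lies in `L_{x+2}` otherwise. -/
theorem stmt_13 (p n : ℕ) (hpn : p ≤ n) (hn : n ≤ 2 * p - 5)
    (x : ℕ) (hx1 : 1 ≤ x) (hx2 : x ≤ n - 1)
    (w : Hgrp n) (hw : w ∈ Lsub n x) :
    (2 * (n - p) < x ∨ Even x →
      Ggen n p (n - 1) * w * (Ggen n p (n - 1))⁻¹ ∈ Lsub n (x + 1)) ∧
    (¬(2 * (n - p) < x ∨ Even x) →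
      Ggen n p (n - 1) * w * (Ggen n p (n - 1))⁻¹ ∈ Lsub n (x + 2)) := by
  have hG : Ggen n p (n - 1) = Oprod n 3 (2 * (n - p) + 1) * Eprod n 2 (2 * (n - p)) *
      Aprod n (2 * (n - p) + 2) (n - 1) := by
    rw [Ggen, if_neg (by omega), if_neg (by omega)]
  have hsplit : ∀ a b c : Hgrp n, a * b * c * w * (a * b * c)⁻¹ =
      a * (b * (c * w * c⁻¹) * b⁻¹) * a⁻¹ := by
    intro a b c
    group
  rw [hG, hsplit]
  constructor
  · intro h
    by_cases hx : 2 * (n - p) < x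
    · refine conj_list n (x + 1) _ ?_ _ (conj_list n (x + 1) _ ?_ _ (conj_A n x _ _ w hw))
      all_goals
        intro i hi
        rw [List.mem_range'] at hi
        obtain ⟨t, _, rfl⟩ := hi
        omega
    · have he : x % 2 = 0 := Nat.even_iff.1 (h.resolve_left hx)
      refine conj_list n (x + 1) _ ?_ _ (Lsub_mono n (Nat.le_succ x)
        (conj_list n x _ ?_ _ (conj_list n x _ ?_ w hw)))
      all_goals
        intro i hi
        rw [List.mem_range'] at hi
        obtain ⟨t, _, rfl⟩ := hi
        omega
  · intro h
    rw [not_or, Nat.not_even_iff] at h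
    refine conj_list n (x + 2) _ ?_ _ (Lsub_mono n (Nat.le_succ (x + 1))
      (conj_list n (x + 1) _ ?_ _ (Lsub_mono n (Nat.le_succ x) (conj_list n x _ ?_ w hw))))
    all_goals
      intro i hi
      rw [List.mem_range'] at hi
      obtain ⟨t, _, rfl⟩ := hi
      omega
end

section
/- Let p and n be integers with p ≤ n ≤ 2p−5 and set φ := n − p. For every 1 ≤ x ≤ n−1 and every W ∈ U_x, the conjugate G_{n−1} · W · G_{n−1}⁻¹ lies in U_{2φ−1} if x ≥ 2φ, and lies in U_{2⌊x/2⌋−1} if x < 2φ. -/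
theorem hgen_mem_Usub (n m i : ℕ) (h : m ≤ i) : hgen n i ∈ Usub n m := by
  by_cases hi : 1 ≤ i ∧ i ≤ n - 1
  · exact Subgroup.subset_closure ⟨i, by omega, hi.2, rfl⟩
  · unfold hgen
    rw [dif_neg hi]
    exact one_mem _

theorem hgen_mem_normalizer (n m i : ℕ) (h : m ≤ i ∨ i + 1 < m) :
    hgen n i ∈ Subgroup.normalizer (Usub n m : Set (Hgrp n)) := by
  rcases h with h | h
  · exact Subgroup.le_normalizer (hgen_mem_Usub n m i h)
  · have hc : ∀ w ∈ Usub n m, w * hgen n i = hgen n i * w := by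
      intro w hw
      have hle : Usub n m ≤ Subgroup.centralizer {hgen n i} := by
        unfold Usub
        rw [Subgroup.closure_le]
        rintro _ ⟨j, hj, -, rfl⟩
        rw [SetLike.mem_coe, Subgroup.mem_centralizer_singleton_iff]
        first
          | exact hgen_comm n i j (by omega)
          | exact (hgen_comm n i j (by omega)).symm
      have := Subgroup.mem_centralizer_singleton_iff.1 (hle hw)
      first
        | exact this
        | exact this.symm
    rw [Subgroup.mem_normalizer_iff]
    intro w
    constructor
    · intro hw
      rwa [← hc w hw, mul_inv_cancel_right]
    · intro hw
      have h2 := hc _ hw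
      rw [inv_mul_cancel_right] at h2
      have h3 := mul_left_cancel h2
      rwa [← h3] at hw

theorem list_mem_normalizer (n m : ℕ) (l : List ℕ) (h : ∀ i ∈ l, m ≤ i ∨ i + 1 < m) :
    (l.map (hgen n)).prod ∈ Subgroup.normalizer (Usub n m : Set (Hgrp n)) := by
  apply Subgroup.list_prod_mem
  intro y hy
  obtain ⟨i, hi, rfl⟩ := List.mem_map.1 hy
  exact hgen_mem_normalizer n m i (h i hi)

theorem Usub_anti (n : ℕ) {a b : ℕ} (h : a ≤ b) : Usub n b ≤ Usub n a := by
  apply Subgroup.closure_mono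
  rintro _ ⟨i, h1, h2, rfl⟩
  exact ⟨i, by omega, h2, rfl⟩

theorem conj_aux (n f m : ℕ) (hm : m ≤ f) (W : Hgrp n) (hW : W ∈ Usub n (2 * m)) :
    (Oprod n 3 (2 * f + 1) * Eprod n 2 (2 * f) * Aprod n (2 * f + 2) (n - 1)) * W *
      (Oprod n 3 (2 * f + 1) * Eprod n 2 (2 * f) * Aprod n (2 * f + 2) (n - 1))⁻¹
        ∈ Usub n (2 * m - 1) := by
  have hA : Aprod n (2 * f + 2) (n - 1) ∈
      Subgroup.normalizer (Usub n (2 * m) : Set (Hgrp n)) := by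
    apply list_mem_normalizer
    intro i hi
    obtain ⟨k, hk, rfl⟩ := List.mem_range'.1 hi
    omega
  have hE : Eprod n 2 (2 * f) ∈ Subgroup.normalizer (Usub n (2 * m) : Set (Hgrp n)) := by
    apply list_mem_normalizer
    intro i hi
    obtain ⟨k, hk, rfl⟩ := List.mem_range'.1 hi
    omega
  have hO : Oprod n 3 (2 * f + 1) ∈
      Subgroup.normalizer (Usub n (2 * m - 1) : Set (Hgrp n)) := by
    apply list_mem_normalizer
    intro i hi
    obtain ⟨k, hk, rfl⟩ := List.mem_range'.1 hi
    omega
  have h1 := (Subgroup.mem_normalizer_iff.1 (mul_mem hE hA) W).1 hW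
  have h2 := (Subgroup.mem_normalizer_iff.1 hO _).1
    (Usub_anti n (show 2 * m - 1 ≤ 2 * m by omega) h1)
  convert h2 using 1
  group

/-- Lemma 6.7, item 2 (generic form):  for `p ≤ n ≤ 2p - 5`, `1 ≤ x ≤ n-1` and any
`W` in the subgroup `U_x` of `H_n`, the conjugate `G_{n-1} W G_{n-1}⁻¹` lies in
`U_{2φ-1}` if `x ≥ 2φ`, and lies in `U_{2⌊x/2⌋-1}` if `x < 2φ`. -/
theorem stmt_17 (p n : ℕ) (hpn : p ≤ n) (hn : n ≤ 2 * p - 5)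
    (x : ℕ) (hx1 : 1 ≤ x) (hx2 : x ≤ n - 1)
    (W : Hgrp n) (hW : W ∈ Usub n x) :
    (2 * (n - p) ≤ x →
      Ggen n p (n - 1) * W * (Ggen n p (n - 1))⁻¹ ∈ Usub n (2 * (n - p) - 1)) ∧
    (x < 2 * (n - p) →
      Ggen n p (n - 1) * W * (Ggen n p (n - 1))⁻¹ ∈ Usub n (2 * (x / 2) - 1)) := by
  have hG : Ggen n p (n - 1) = Oprod n 3 (2 * (n - p) + 1) * Eprod n 2 (2 * (n - p)) *
      Aprod n (2 * (n - p) + 2) (n - 1) := by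
    unfold Ggen
    rw [if_neg (by omega), if_neg (by omega)]
  rw [hG]
  constructor
  · intro h
    exact conj_aux n (n - p) (n - p) le_rfl W (Usub_anti n h hW)
  · intro h
    exact conj_aux n (n - p) (x / 2) (by omega) W (Usub_anti n (by omega) hW)
end

section
/- Let p and n be integers with p ≤ n ≤ 2p−5 and set φ := n − p, so φ ≥ 1. Let h_1, …, h_{n−1} be elements of a group G and write h(a,b) := h_b · h_a; products over empty index ranges are the identity, except that the expression h(2,3)h(4,5)⋯h(2k,2k+1) is interpreted as h_1 when k = 0. Assume the following commutation relations hold in G: (i)(a) for all 2φ+1 ≤ i < j ≤ n−2, h(2,3)h(4,5)⋯h(2φ,2φ+1)·h_{2φ+2}⋯h_i commutes with h_{j+1}⋯h_{n−1}; (i)(b) for all 2φ < j ≤ n−2, h(2,3)⋯h(2φ−2,2φ−1)·h_{2φ} commutes with h_{j+1}⋯h_{n−1}; (ii)(a) for all k ≥ 1 with 2k < 2φ and all 2φ+1 ≤ j ≤ n−2, h(2,3)⋯h(2k−2,2k−1)·h_{2k} commutes with h_{j+1}⋯h_{n−1}; (ii)(b) for all k, ℓ with 2 ≤ 2k < 2ℓ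 ≤ 2φ, h(2,3)⋯h(2k−2,2k−1)·h_{2k} commutes with h_{2ℓ}⁻¹·h(2ℓ,2ℓ+1)⋯h(2φ,2φ+1)·h_{2φ+2}⋯h_{n−1}; (ii)(c) for all k, ℓ with 2 ≤ 2k < 2ℓ+1 < 2φ, h(2,3)⋯h(2k−2,2k−1)·h_{2k} commutes with h(2ℓ+2,2ℓ+3)⋯h(2φ,2φ+1)·h_{2φ+2}⋯h_{n−1}; (iii)(a) for all k ≥ 0 with 2k+1 < 2φ and all 2φ+1 ≤ j ≤ n−2, h(2,3)⋯h(2k,2k+1) commutes with h_{j+1}⋯h_{n−1}; (iii)(b) for all k, ℓ with 2k+2 < 2ℓ ≤ 2φ, h(2,3)⋯h(2k,2k+1) commutes with h_{2ℓ}⁻¹·h(2ℓ,2ℓ+1)⋯h(2φ,2φ+1)·h_{2φ+2}⋯h_{n−1}; (iii)(c) for all k, ℓ with 2k+2 < 2ℓ+1 < 2φ, h(2,3)⋯h(2k,2k+1) commutes with h(2ℓ+2,2ℓ+3)⋯h(2φ,2φ+1)·h_{2φ+2}⋯h_{n−1}; (iv) for all k ≥ 0 with 2k+1 < 2φ, h(2,3)⋯h(2k,2k+1)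 commutes with h(2,3)⋯h(2φ,2φ+1)·h_{2φ+2}⋯h_{n−1}·(h(2,3)⋯h(2k,2k+1)·h_{2k+2})⁻¹. Then h_u commutes with h_v for all indices 1 ≤ u, v ≤ n−1 with v − u ≥ 2. -/
/-- `h(a,b) := h_b · h_a` (note the swapping of factors). -/
def hPair {G : Type*} [Group G] (h : ℕ → G) (a b : ℕ) : G := h b * h a

/-- `CSeg h a b := h(2a, 2a+1) · h(2a+2, 2a+3) ⋯ h(2b, 2b+1)`
(the identity when `a > b`). -/
def CSeg {G : Type*} [Group G] (h : ℕ → G) (a b : ℕ) : G :=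
  ((List.range' a (b + 1 - a) 1).map (fun k => hPair h (2 * k) (2 * k + 1))).prod

/-- `CK h k := h(2,3)·h(4,5) ⋯ h(2k, 2k+1)`, with the convention that this
expression is interpreted as `h_1` when `k = 0`. -/
def CK {G : Type*} [Group G] (h : ℕ → G) (k : ℕ) : G :=
  if k = 0 then h 1 else CSeg h 1 k

/-- `ARun h a b := h_a · h_{a+1} ⋯ h_b` (the identity when `a > b`). -/
def ARun {G : Type*} [Group G] (h : ℕ → G) (a b : ℕ) : G :=
  ((List.range' a (b + 1 - a) 1).map h).prod

section Helpers

variable {G : Type*} [Group G]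

lemma cseg_last (h : ℕ → G) (k : ℕ) :
    CSeg h 1 (k + 1) = CSeg h 1 k * (h (2 * k + 3) * h (2 * k + 2)) := by
  unfold CSeg
  rw [show k + 1 + 1 - 1 = k + 1 by omega, show k + 1 - 1 = k by omega,
    List.range'_concat]
  simp [hPair, show 2 * (1 + k) = 2 * k + 2 by ring]

lemma cseg_head (h : ℕ → G) (l b : ℕ) (hl : l ≤ b) :
    CSeg h l b = h (2 * l + 1) * h (2 * l) * CSeg h (l + 1) b := by
  unfold CSeg
  rw [show b + 1 - l = (b - l) + 1 by omega, show b + 1 - (l + 1) = b - l by omega,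
    List.range'_succ]
  simp [hPair]

lemma cseg_empty (h : ℕ → G) (l b : ℕ) (hl : b < l) : CSeg h l b = 1 := by
  unfold CSeg
  rw [show b + 1 - l = 0 by omega]
  simp

lemma cseg_split (h : ℕ → G) (f k : ℕ) (hk : k ≤ f) :
    CSeg h 1 f = CSeg h 1 k * CSeg h (k + 1) f := by
  induction k with
  | zero => rw [cseg_empty h 1 0 (by omega), one_mul]
  | succ k ih =>
    rw [ih (by omega), cseg_head h (k + 1) f hk, cseg_last]
    simp only [mul_assoc]
    rfl

lemma arun_empty (h : ℕ → G) (l b : ℕ) (hl : b < l) : ARun h l b = 1 := by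
  unfold ARun
  rw [show b + 1 - l = 0 by omega]
  simp

lemma arun_head (h : ℕ → G) (l b : ℕ) (hl : l ≤ b) :
    ARun h l b = h l * ARun h (l + 1) b := by
  unfold ARun
  rw [show b + 1 - l = (b - l) + 1 by omega, show b + 1 - (l + 1) = b - l by omega,
    List.range'_succ]
  simp

lemma arun_last (h : ℕ → G) (a b : ℕ) (hl : a ≤ b + 1) :
    ARun h a (b + 1) = ARun h a b * h (b + 1) := by
  unfold ARun
  rw [show b + 1 + 1 - a = (b + 1 - a) + 1 by omega, List.range'_concat]
  simp [show a + (b + 1 - a) = b + 1 by omega]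

lemma comm_cancel_right {x a b : G} (h1 : Commute x (a * b)) (h2 : Commute x b) :
    Commute x a := by
  simpa using h1.mul_right h2.inv_right

lemma comm_cancel_left {x a b : G} (h1 : Commute x (a * b)) (h2 : Commute x a) :
    Commute x b := by
  simpa using h2.inv_right.mul_right h1

lemma comm_arun (h : ℕ → G) (x : G) (a b : ℕ)
    (H : ∀ m, a ≤ m → m ≤ b → Commute x (h m)) : Commute x (ARun h a b) := by
  unfold ARun
  apply Commute.list_prod_right
  intro y hy
  simp only [List.mem_map, List.mem_range'_1] at hy
  obtain ⟨m, hm, rfl⟩ := hy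
  exact H m (by omega) (by omega)

lemma comm_cseg (h : ℕ → G) (x : G) (a b : ℕ)
    (H : ∀ m, 2 * a ≤ m → m ≤ 2 * b + 1 → Commute x (h m)) : Commute x (CSeg h a b) := by
  unfold CSeg
  apply Commute.list_prod_right
  intro y hy
  simp only [List.mem_map, List.mem_range'_1] at hy
  obtain ⟨m, hm, rfl⟩ := hy
  exact (H _ (by omega) (by omega)).mul_right (H _ (by omega) (by omega))

lemma comm_of_tails (h : ℕ → G) (x : G) (J N : ℕ)
    (H : ∀ m, J ≤ m → m ≤ N → Commute x (ARun h m N)) :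
    ∀ m, J ≤ m → m ≤ N → Commute x (h m) := by
  intro m h1 h2
  have h3 := H m h1 h2
  rw [arun_head h m N h2] at h3
  refine comm_cancel_right h3 ?_
  rcases Nat.lt_or_ge m N with h4 | h4
  · exact H (m + 1) (by omega) (by omega)
  · rw [arun_empty h (m + 1) N (by omega)]
    exact Commute.one_right x

lemma comm_of_E (h : ℕ → G) (x : G) (K f N : ℕ)
    (HT : ∀ m, 2 * f + 2 ≤ m → m ≤ N → Commute x (h m))
    (HE : ∀ l, K ≤ l → l ≤ f → Commute x (CSeg h l f * ARun h (2 * f + 2) N))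
    (HO : ∀ l, K ≤ l → l ≤ f →
      Commute x ((h (2 * l))⁻¹ * CSeg h l f * ARun h (2 * f + 2) N)) :
    ∀ m, 2 * K ≤ m → m ≤ N → Commute x (h m) := by
  intro m h1 h2
  rcases Nat.lt_or_ge (2 * f + 1) m with h3 | h3
  · exact HT m h3 h2
  have key : ∀ l, K ≤ l → l ≤ f → Commute x (h (2 * l)) := by
    intro l a b
    have h4 := HO l a b
    rw [mul_assoc] at h4
    simpa using (comm_cancel_right h4 (HE l a b)).inv_right
  have key2 : ∀ l, K ≤ l → l ≤ f → Commute x (h (2 * l + 1)) := by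
    intro l a b
    have h4 := HE l a b
    rw [cseg_head h l f b, mul_assoc] at h4
    refine comm_cancel_right (comm_cancel_right h4 ?_) (key l a b)
    rcases Nat.lt_or_ge l f with h5 | h5
    · exact HE (l + 1) (by omega) (by omega)
    · rw [cseg_empty h (l + 1) f (by omega), one_mul]
      exact comm_arun h x _ _ HT
  rcases Nat.even_or_odd' m with ⟨l, rfl | rfl⟩
  · exact key l (by omega) (by omega)
  · exact key2 l (by omega) (by omega)

lemma main_aux (f N : ℕ) (hf : 1 ≤ f) (hN : 2 * f + 2 ≤ N) (h : ℕ → G)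
    (hia : ∀ i m : ℕ, 2 * f + 1 ≤ i → i + 2 ≤ m → m ≤ N →
      Commute (CSeg h 1 f * ARun h (2 * f + 2) i) (ARun h m N))
    (hQT : ∀ k m : ℕ, k < f → 2 * f + 2 ≤ m → m ≤ N →
      Commute (CSeg h 1 k * h (2 * k + 2)) (ARun h m N))
    (hQO : ∀ k l : ℕ, k + 2 ≤ l → l ≤ f →
      Commute (CSeg h 1 k * h (2 * k + 2))
        ((h (2 * l))⁻¹ * CSeg h l f * ARun h (2 * f + 2) N))
    (hQE : ∀ k l : ℕ, k + 2 ≤ l → l ≤ f →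
      Commute (CSeg h 1 k * h (2 * k + 2)) (CSeg h l f * ARun h (2 * f + 2) N))
    (hPT : ∀ k m : ℕ, k < f → 2 * f + 2 ≤ m → m ≤ N → Commute (CK h k) (ARun h m N))
    (hPO : ∀ k l : ℕ, k + 2 ≤ l → l ≤ f →
      Commute (CK h k) ((h (2 * l))⁻¹ * CSeg h l f * ARun h (2 * f + 2) N))
    (hPE : ∀ k l : ℕ, k + 2 ≤ l → l ≤ f →
      Commute (CK h k) (CSeg h l f * ARun h (2 * f + 2) N))
    (hiv : ∀ k : ℕ, k < f →
      Commute (CK h k)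
        (CSeg h 1 f * ARun h (2 * f + 2) N * (CK h k * h (2 * k + 2))⁻¹)) :
    ∀ u v : ℕ, 1 ≤ u → v ≤ N → u + 2 ≤ v → Commute (h u) (h v) := by
  have S1 : ∀ k m, k < f → 2 * k + 4 ≤ m → m ≤ N →
      Commute (CSeg h 1 k * h (2 * k + 2)) (h m) := by
    intro k m hk h1 h2
    exact comm_of_E h _ (k + 2) f N (comm_of_tails h _ _ N (fun m => hQT k m hk))
      (hQE k) (hQO k) m (by omega) h2
  have S2 : ∀ k m, k < f → 2 * k + 4 ≤ m → m ≤ N → Commute (CK h k) (h m) := by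
    intro k m hk h1 h2
    exact comm_of_E h _ (k + 2) f N (comm_of_tails h _ _ N (fun m => hPT k m hk))
      (hPE k) (hPO k) m (by omega) h2
  have hCK1 : ∀ k, CK h (k + 1) = CSeg h 1 (k + 1) := fun k => by simp [CK]
  have hCK0 : CK h 0 = h 1 := by simp [CK]
  have hC0 : CSeg h 1 0 = 1 := cseg_empty h 1 0 (by omega)
  have S2' : ∀ k m, k < f → 2 * k + 4 ≤ m → m ≤ N → Commute (CSeg h 1 k) (h m) := by
    intro k m hk h1 h2
    cases k with
    | zero => rw [hC0]; exact Commute.one_left _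
    | succ k => rw [← hCK1]; exact S2 _ m hk h1 h2
  have Ev : ∀ k m, k < f → 2 * k + 4 ≤ m → m ≤ N → Commute (h (2 * k + 2)) (h m) := by
    intro k m hk h1 h2
    exact (comm_cancel_left (S1 k m hk h1 h2).symm (S2' k m hk h1 h2).symm).symm
  have Od : ∀ k m, k < f → 2 * k + 4 ≤ m → m ≤ N → Commute (h (2 * k + 1)) (h m) := by
    intro k m hk h1 h2
    cases k with
    | zero => simpa [hCK0] using S2 0 m hk h1 h2
    | succ k =>
      have h3 := (S2' (k + 1) m hk h1 h2).symm
      rw [cseg_last] at h3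
      have h4 := comm_cancel_left h3 (S2' k m (by omega) (by omega) h2).symm
      exact (comm_cancel_right h4 (Ev k m (by omega) (by omega) h2).symm).symm
  have S3 : ∀ k, k < f → Commute (CK h k) (h (2 * k + 3)) := by
    intro k hk
    have hE : ∀ y, (∀ m, 2 * k + 4 ≤ m → m ≤ N → Commute y (h m)) →
        Commute y (CSeg h (k + 2) f * ARun h (2 * f + 2) N) := fun y hy =>
      (comm_cseg h y _ _ (fun m a b => hy m (by omega) (by omega))).mul_right
        (comm_arun h y _ _ (fun m a b => hy m (by omega) (by omega)))
    have e1 := hE _ (fun m => S2 k m hk)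
    have e2 := hE _ (fun m => Ev k m hk)
    have h3 := hiv k hk
    rw [cseg_split h f k hk.le, cseg_head h (k + 1) f (by omega)] at h3
    simp only [show 2 * (k + 1) = 2 * k + 2 by ring, show 2 * k + 2 + 1 = 2 * k + 3 by ring,
      show k + 1 + 1 = k + 2 by ring] at h3
    generalize hEE : CSeg h (k + 2) f * ARun h (2 * f + 2) N = E at e1 e2
    have h4 : CSeg h 1 k * (h (2 * k + 3) * h (2 * k + 2) * CSeg h (k + 2) f)
        * ARun h (2 * f + 2) N * (CK h k * h (2 * k + 2))⁻¹
        = CSeg h 1 k * (h (2 * k + 3) * E * (CK h k)⁻¹) := by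
      have : h (2 * k + 2) * E * (h (2 * k + 2))⁻¹ = E := by rw [e2.eq]; group
      conv_rhs => rw [← this, ← hEE]
      group
    rw [h4] at h3
    have h5 : Commute (CK h k) (CSeg h 1 k) := by
      cases k with
      | zero => rw [hC0]; exact Commute.one_right _
      | succ k => rw [hCK1]
    exact comm_cancel_right
      (comm_cancel_right (comm_cancel_left h3 h5) (Commute.refl _).inv_right) e1
  have Od3 : ∀ k, k < f → Commute (h (2 * k + 1)) (h (2 * k + 3)) := by
    intro k hk
    have h3 := S3 k hk
    cases k with
    | zero => simpa [hCK0] using h3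
    | succ k =>
      rw [hCK1, cseg_last] at h3
      have h4 := comm_cancel_left h3.symm (S2' k _ (by omega) (by omega) (by omega)).symm
      exact (comm_cancel_right h4 (Ev k _ (by omega) (by omega) (by omega)).symm).symm
  have low : ∀ u v : ℕ, 1 ≤ u → u ≤ 2 * f → v ≤ N → u + 2 ≤ v → Commute (h u) (h v) := by
    intro u v h1 h2 h3 h4
    rcases Nat.even_or_odd' u with ⟨l, rfl | rfl⟩
    · obtain ⟨k, rfl⟩ : ∃ k, l = k + 1 := ⟨l - 1, by omega⟩
      exact Ev k v (by omega) (by omega) h3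
    · rcases Nat.eq_or_lt_of_le h4 with h5 | h5
      · subst h5
        exact Od3 l (by omega)
      · exact Od l v (by omega) (by omega) h3
  have mid : ∀ i m, 2 * f + 1 ≤ i → i + 2 ≤ m → m ≤ N →
      Commute (CSeg h 1 f * ARun h (2 * f + 2) i) (h m) := by
    intro i m a b c
    exact comm_of_tails h _ (i + 2) N (fun m => hia i m a) m b c
  intro u v h1 h2 h3
  rcases Nat.lt_or_ge (2 * f) u with h4 | h4
  swap
  · exact low u v h1 h4 h2 h3
  rcases Nat.eq_or_lt_of_le h4 with h5 | h5
  · have h6 := mid u v (by omega) h3 h2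
    rw [arun_empty h _ u (by omega), mul_one] at h6
    cases f with
    | zero => omega
    | succ k =>
      rw [cseg_last] at h6
      have h7 := comm_cancel_left h6.symm (S2' k v (by omega) (by omega) h2).symm
      have h8 := comm_cancel_right h7 (Ev k v (by omega) (by omega) h2).symm
      have : u = 2 * k + 3 := by omega
      rw [this]
      exact h8.symm
  · obtain ⟨i, rfl⟩ : ∃ i, u = i + 1 := ⟨u - 1, by omega⟩
    have h6 := mid (i + 1) v (by omega) h3 h2
    rw [arun_last h _ i (by omega), ← mul_assoc] at h6
    exact (comm_cancel_left h6.symm (mid i v (by omega) (by omega) h2).symm).symm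

end Helpers

/-- Proposition 6.8.  Let `p ≤ n ≤ 2p - 5`, `φ := n - p ≥ 1`, and let
`h_1, …, h_{n-1}` be elements of a group `G`, with `h(a,b) := h_b h_a` and the
conventions on empty products described above.  If the listed commutation
relations (i)(a)–(iv) hold in `G`, then `h_u` commutes with `h_v` for all
`1 ≤ u, v ≤ n-1` with `v - u ≥ 2`. -/
theorem stmt_19 {G : Type*} [Group G] (p n : ℕ) (hpn : p ≤ n) (hn : n ≤ 2 * p - 5)
    (hphi : 1 ≤ n - p) (h : ℕ → G)
    -- (i)(a)
    (hia : ∀ i j : ℕ, 2 * (n - p) + 1 ≤ i → i < j → j ≤ n - 2 →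
      Commute (CSeg h 1 (n - p) * ARun h (2 * (n - p) + 2) i) (ARun h (j + 1) (n - 1)))
    -- (i)(b)
    (hib : ∀ j : ℕ, 2 * (n - p) < j → j ≤ n - 2 →
      Commute (CSeg h 1 (n - p - 1) * h (2 * (n - p))) (ARun h (j + 1) (n - 1)))
    -- (ii)(a)
    (hiia : ∀ k j : ℕ, 1 ≤ k → 2 * k < 2 * (n - p) → 2 * (n - p) + 1 ≤ j → j ≤ n - 2 →
      Commute (CSeg h 1 (k - 1) * h (2 * k)) (ARun h (j + 1) (n - 1)))
    -- (ii)(b)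
    (hiib : ∀ k l : ℕ, 1 ≤ k → k < l → l ≤ n - p →
      Commute (CSeg h 1 (k - 1) * h (2 * k))
        ((h (2 * l))⁻¹ * CSeg h l (n - p) * ARun h (2 * (n - p) + 2) (n - 1)))
    -- (ii)(c)
    (hiic : ∀ k l : ℕ, 1 ≤ k → 2 * k < 2 * l + 1 → 2 * l + 1 < 2 * (n - p) →
      Commute (CSeg h 1 (k - 1) * h (2 * k))
        (CSeg h (l + 1) (n - p) * ARun h (2 * (n - p) + 2) (n - 1)))
    -- (iii)(a)
    (hiiia : ∀ k j : ℕ, 2 * k + 1 < 2 * (n - p) → 2 * (n - p) + 1 ≤ j → j ≤ n - 2 →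
      Commute (CK h k) (ARun h (j + 1) (n - 1)))
    -- (iii)(b)
    (hiiib : ∀ k l : ℕ, 2 * k + 2 < 2 * l → l ≤ n - p →
      Commute (CK h k)
        ((h (2 * l))⁻¹ * CSeg h l (n - p) * ARun h (2 * (n - p) + 2) (n - 1)))
    -- (iii)(c)
    (hiiic : ∀ k l : ℕ, 2 * k + 2 < 2 * l + 1 → 2 * l + 1 < 2 * (n - p) →
      Commute (CK h k)
        (CSeg h (l + 1) (n - p) * ARun h (2 * (n - p) + 2) (n - 1)))
    -- (iv)
    (hiv : ∀ k : ℕ, 2 * k + 1 < 2 * (n - p) →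
      Commute (CK h k)
        (CSeg h 1 (n - p) * ARun h (2 * (n - p) + 2) (n - 1) *
          (CK h k * h (2 * k + 2))⁻¹)) :
    ∀ u v : ℕ, 1 ≤ u → v ≤ n - 1 → u + 2 ≤ v → Commute (h u) (h v) := by
  have e1 : n - 1 = n - 2 + 1 := by omega
  refine main_aux (n - p) (n - 1) hphi (by omega) h ?_ ?_ ?_ ?_ ?_ ?_ ?_ ?_
  · intro i m a b c
    have := hia i (m - 1) a (by omega) (by omega)
    rwa [show m - 1 + 1 = m by omega] at this
  · intro k m a b c
    rcases Nat.eq_or_lt_of_le (show k + 1 ≤ n - p from a) with e | e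
    · have := hib (m - 1) (by omega) (by omega)
      rwa [show m - 1 + 1 = m by omega, show n - p - 1 = k by omega,
        show 2 * (n - p) = 2 * k + 2 by omega] at this
    · have := hiia (k + 1) (m - 1) (by omega) (by omega) (by omega) (by omega)
      rwa [show m - 1 + 1 = m by omega] at this
  · intro k l a b
    exact hiib (k + 1) l (by omega) (by omega) b
  · intro k l a b
    have := hiic (k + 1) (l - 1) (by omega) (by omega) (by omega)
    rwa [show l - 1 + 1 = l by omega] at this
  · intro k m a b c
    have := hiiia k (m - 1) (by omega) (by omega) (by omega)
    rwa [show m - 1 + 1 = m by omega] at this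
  · intro k l a b
    exact hiiib k l (by omega) b
  · intro k l a b
    have := hiiic k (l - 1) (by omega) (by omega)
    rwa [show l - 1 + 1 = l by omega] at this
  · intro k a
    exact hiv k (by omega)
end
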